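/- Let k ≥ 2, let ω be a positive semidefinite matrix on ℂ^{dA} ⊗ ℂ^{dB} and ω' a positive semidefinite matrix on ℂ^{dA'} ⊗ ℂ^{dB'}. Then the support function of the PPT_k set is sub-multiplicative: h_{PPT_k(AA':BB')}(ω ⊗ ω') ≤ h_{PPT_k(A:B)}(ω) · h_{PPT_k(A':B')}(ω'), where the Kronecker product is reindexed so that the bipartition is (A×A') versus (B×B'). -/

import Mathlib

open scoped Kronecker ComplexOrder Matrix

attribute [local instance] Classical.propDecidable

noncomputable section

namespace QIT

variable {n : Type*} [Fintype n] [DecidableEq n]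

/-- Base-2 matrix logarithm taken on the support (junk value `0` for non-Hermitian input). -/
def matLog (A : Matrix n n ℂ) : Matrix n n ℂ :=
  if hA : A.IsHermitian then
    (hA.eigenvectorUnitary : Matrix n n ℂ) *
      Matrix.diagonal (fun i => if hA.eigenvalues i = 0 then (0 : ℂ)
        else (Real.logb 2 (hA.eigenvalues i) : ℂ)) *
      (hA.eigenvectorUnitary : Matrix n n ℂ)ᴴ
  else 0

/-- Orthogonal projection onto the support of a Hermitian matrix. -/
def suppProj (A : Matrix n n ℂ) : Matrix n n ℂ :=
  if hA : A.IsHermitian then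
    (hA.eigenvectorUnitary : Matrix n n ℂ) *
      Matrix.diagonal (fun i => if hA.eigenvalues i = 0 then (0 : ℂ) else 1) *
      (hA.eigenvectorUnitary : Matrix n n ℂ)ᴴ
  else 0

/-- Support inclusion `supp ρ ⊆ supp σ`, phrased via kernels. -/
def suppLE (ρ σ : Matrix n n ℂ) : Prop :=
  ∀ x : n → ℂ, σ.mulVec x = 0 → ρ.mulVec x = 0

/-- Umegaki relative entropy (base 2), `+∞` when supports are not included. -/
def relEnt (ρ σ : Matrix n n ℂ) : EReal :=
  if suppLE ρ σ then (((ρ * (matLog ρ - matLog σ)).trace).re : EReal) else ⊤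

/-- Classical relative-entropy summand `p log₂(p/q)` with conventions
`0 · log(0/q) = 0` and `p · log(p/0) = +∞` for `p ≠ 0`. -/
def klTerm (p q : ℝ) : EReal :=
  if p = 0 then 0 else if q = 0 then ⊤ else ((p * Real.logb 2 (p / q) : ℝ) : EReal)

/-- A finite POVM. -/
def IsPOVM {m : ℕ} (M : Fin m → Matrix n n ℂ) : Prop :=
  (∀ x, (M x).PosSemidef) ∧ ∑ x, M x = 1

/-- Measured relative entropy (base 2). -/
def measRelEnt (ρ σ : Matrix n n ℂ) : EReal :=
  ⨆ (m : ℕ) (M : Fin m → Matrix n n ℂ) (_ : IsPOVM M),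
    ∑ x, klTerm ((M x * ρ).trace).re ((M x * σ).trace).re

/-- Trace norm: sum of singular values. -/
def traceNorm (A : Matrix n n ℂ) : ℝ :=
  ∑ i, Real.sqrt ((Matrix.posSemidef_conjTranspose_mul_self A).1.eigenvalues i)

/-- Operator (spectral) norm: largest singular value. -/
def opNorm (A : Matrix n n ℂ) : ℝ :=
  ⨆ i, Real.sqrt ((Matrix.posSemidef_conjTranspose_mul_self A).1.eigenvalues i)

/-- Partial transpose on the second tensor factor. -/
def ptB {α β : Type*} (X : Matrix (α × β) (α × β) ℂ) : Matrix (α × β) (α × β) ℂ :=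
  Matrix.of fun p q => X (p.1, q.2) (q.1, p.2)

/-- Kronecker product of two bipartite matrices, reindexed to the bipartition (A×A') : (B×B'). -/
def kron2 {α β γ δ : Type*} (X : Matrix (α × β) (α × β) ℂ) (Y : Matrix (γ × δ) (γ × δ) ℂ) :
    Matrix ((α × γ) × β × δ) ((α × γ) × β × δ) ℂ :=
  Matrix.reindex (Equiv.prodProdProdComm α β γ δ) (Equiv.prodProdProdComm α β γ δ) (X ⊗ₖ Y)

/-- The permutation unitary on `(ℂ^d)^{⊗ m}`. -/
def permMat (d m : ℕ) (π : Equiv.Perm (Fin m)) :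
    Matrix (Fin m → Fin d) (Fin m → Fin d) ℂ :=
  Matrix.of fun f g => if f ∘ π = g then 1 else 0

/-- Membership in the `PPT_k` set. -/
def memPPTk {α β : Type*} [Fintype α] [Fintype β] [DecidableEq α] [DecidableEq β]
    (k : ℕ) (X : Matrix (α × β) (α × β) ℂ) : Prop :=
  X.PosSemidef ∧ ∃ ω : ℕ → Matrix (α × β) (α × β) ℂ,
    ω 1 = X ∧ (∀ i ∈ Finset.Icc 1 k, (ω i).IsHermitian) ∧
    (∀ i ∈ Finset.Icc 1 (k - 1),
      ((ω (i + 1)) - ptB (ω i)).PosSemidef ∧ ((ω (i + 1)) + ptB (ω i)).PosSemidef) ∧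
    traceNorm (ptB (ω k)) ≤ 1

/-- Membership in the Rains set. -/
def memRains {α β : Type*} [Fintype α] [Fintype β] [DecidableEq α] [DecidableEq β]
    (σ : Matrix (α × β) (α × β) ℂ) : Prop :=
  σ.PosSemidef ∧ traceNorm (ptB σ) ≤ 1


/-- Support function of the `PPT_k` set. -/
def pptkSuppFn {α β : Type*} [Fintype α] [DecidableEq α] [Fintype β] [DecidableEq β]
    (k : ℕ) (ω : Matrix (α × β) (α × β) ℂ) : ℝ :=
  sSup {r : ℝ | ∃ σ : Matrix (α × β) (α × β) ℂ, memPPTk k σ ∧ r = ((σ * ω).trace).re}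

section PartialTranspose

variable {α β γ δ : Type*}

lemma ptB_add (X Y : Matrix (α × β) (α × β) ℂ) : ptB (X + Y) = ptB X + ptB Y := rfl

lemma ptB_sub (X Y : Matrix (α × β) (α × β) ℂ) : ptB (X - Y) = ptB X - ptB Y := rfl

lemma ptB_neg (X : Matrix (α × β) (α × β) ℂ) : ptB (-X) = -ptB X := rfl

lemma ptB_zero : ptB (0 : Matrix (α × β) (α × β) ℂ) = 0 := rfl

lemma ptB_smul (r : ℝ) (X : Matrix (α × β) (α × β) ℂ) : ptB (r • X) = r • ptB X := rfl

lemma ptB_ptB (X : Matrix (α × β) (α × β) ℂ) : ptB (ptB X) = X := rfl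

lemma ptB_one [DecidableEq α] [DecidableEq β] : ptB (1 : Matrix (α × β) (α × β) ℂ) = 1 := by
  ext ⟨a, b⟩ ⟨c, d⟩
  simp only [ptB, Matrix.of_apply, Matrix.one_apply, Prod.mk.injEq]
  congr 1
  simp [eq_comm]

lemma isHermitian_ptB {X : Matrix (α × β) (α × β) ℂ} (hX : X.IsHermitian) :
    (ptB X).IsHermitian :=
  Matrix.IsHermitian.ext fun p q => hX.apply (p.1, q.2) (q.1, p.2)

lemma trace_ptB_mul_ptB [Fintype α] [Fintype β] (X Y : Matrix (α × β) (α × β) ℂ) :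
    (ptB X * ptB Y).trace = (X * Y).trace := by
  simp only [Matrix.trace, Matrix.diag_apply, Matrix.mul_apply, ptB, Matrix.of_apply,
    Fintype.sum_prod_type]
  refine Finset.sum_congr rfl fun a _ => ?_
  rw [Finset.sum_comm]
  conv_rhs => rw [Finset.sum_comm]
  refine Finset.sum_congr rfl fun c _ => ?_
  rw [Finset.sum_comm]

lemma trace_ptB_mul [Fintype α] [Fintype β] (X Y : Matrix (α × β) (α × β) ℂ) :
    (ptB X * Y).trace = (X * ptB Y).trace := by
  rw [← trace_ptB_mul_ptB X (ptB Y), ptB_ptB]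

lemma ptB_kron2 (X : Matrix (α × β) (α × β) ℂ) (Y : Matrix (γ × δ) (γ × δ) ℂ) :
    ptB (kron2 X Y) = kron2 (ptB X) (ptB Y) := rfl

lemma kron2_one_one [DecidableEq α] [DecidableEq β] [DecidableEq γ] [DecidableEq δ] :
    kron2 (1 : Matrix (α × β) (α × β) ℂ) (1 : Matrix (γ × δ) (γ × δ) ℂ) = 1 := by
  ext ⟨⟨a, c⟩, b, d⟩ ⟨⟨a', c'⟩, b', d'⟩
  simp only [kron2, Matrix.reindex_apply, Matrix.submatrix_apply, Matrix.kroneckerMap_apply,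
    Matrix.one_apply, Equiv.prodProdProdComm_symm, Equiv.prodProdProdComm_apply, Prod.mk.injEq]
  split_ifs <;> simp_all

lemma kron2_apply (X : Matrix (α × β) (α × β) ℂ) (Y : Matrix (γ × δ) (γ × δ) ℂ)
    (p q : (α × γ) × β × δ) :
    kron2 X Y p q = X (p.1.1, p.2.1) (q.1.1, q.2.1) * Y (p.1.2, p.2.2) (q.1.2, q.2.2) := rfl

lemma kron2_smul_smul (r s : ℝ) (X : Matrix (α × β) (α × β) ℂ) (Y : Matrix (γ × δ) (γ × δ) ℂ) :
    kron2 (r • X) (s • Y) = (r * s) • kron2 X Y := by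
  ext p q
  simp only [kron2_apply, Matrix.smul_apply, Complex.real_smul, Complex.ofReal_mul]
  ring

lemma posSemidef_kron2 [Fintype α] [Fintype β] [Fintype γ] [Fintype δ]
    {X : Matrix (α × β) (α × β) ℂ} {Y : Matrix (γ × δ) (γ × δ) ℂ}
    (hX : X.PosSemidef) (hY : Y.PosSemidef) : (kron2 X Y).PosSemidef :=
  (hX.kronecker hY).submatrix _

lemma posSemidef_real_smul {m : Type*} {A : Matrix m m ℂ} (hA : A.PosSemidef) {r : ℝ} (hr : 0 ≤ r) :
    (r • A).PosSemidef :=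
  hA.smul hr

/-- A Kronecker product `X ⊗ Y` is bounded by `V ⊗ W` when `±X ≤ V` and `±Y ≤ W`. -/
lemma posSemidef_kron2_sub [Fintype α] [Fintype β] [Fintype γ] [Fintype δ]
    {X V : Matrix (α × β) (α × β) ℂ} {Y W : Matrix (γ × δ) (γ × δ) ℂ}
    (hX : (V - X).PosSemidef) (hX' : (V + X).PosSemidef)
    (hY : (W - Y).PosSemidef) (hY' : (W + Y).PosSemidef) :
    (kron2 V W - kron2 X Y).PosSemidef ∧ (kron2 V W + kron2 X Y).PosSemidef := by
  constructor
  · convert posSemidef_real_smul ((posSemidef_kron2 hX hY').add (posSemidef_kron2 hX' hY))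
      (r := 1 / 2) (by norm_num) using 1
    ext p q
    simp only [kron2_apply, Matrix.smul_apply, Matrix.sub_apply, Matrix.add_apply,
      Complex.real_smul]
    push_cast
    ring
  · convert posSemidef_real_smul ((posSemidef_kron2 hX hY).add (posSemidef_kron2 hX' hY'))
      (r := 1 / 2) (by norm_num) using 1
    ext p q
    simp only [kron2_apply, Matrix.smul_apply, Matrix.sub_apply, Matrix.add_apply,
      Complex.real_smul]
    push_cast
    ring

end PartialTranspose

section TraceInequalities

open scoped MatrixOrder in
lemma re_trace_mul_nonneg {A B : Matrix n n ℂ} (hA : A.PosSemidef) (hB : B.PosSemidef) :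
    0 ≤ (A * B).trace.re := by
  obtain ⟨C, rfl⟩ := CStarAlgebra.nonneg_iff_eq_star_mul_self.mp hB.nonneg
  rw [← Matrix.mul_assoc, Matrix.trace_mul_comm, ← Matrix.mul_assoc]
  exact (Complex.le_def.mp (hA.mul_mul_conjTranspose_same C).trace_nonneg).1

lemma re_trace_mul_le {X W Y V : Matrix n n ℂ} (hX : (W - X).PosSemidef) (hX' : (W + X).PosSemidef)
    (hY : (V - Y).PosSemidef) (hY' : (V + Y).PosSemidef) :
    (X * Y).trace.re ≤ (W * V).trace.re := by
  have h₁ := re_trace_mul_nonneg hX hY'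
  have h₂ := re_trace_mul_nonneg hX' hY
  simp only [sub_mul, mul_sub, add_mul, mul_add, Matrix.trace_sub, Matrix.trace_add,
    Complex.sub_re, Complex.add_re] at h₁ h₂
  linarith

open scoped MatrixOrder in
lemma trace_cfc {A : Matrix n n ℂ} (hA : A.IsHermitian) (f : ℝ → ℝ) :
    (cfc f A).trace.re = ∑ i, f (hA.eigenvalues i) := by
  rw [hA.cfc_eq, Matrix.IsHermitian.cfc, Unitary.conjStarAlgAut_apply, Matrix.trace_mul_cycle,
    Unitary.coe_star_mul_self, one_mul, Matrix.trace_diagonal]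
  simp

open scoped MatrixOrder in
lemma traceNorm_eq_trace_abs (A : Matrix n n ℂ) : traceNorm A = (CFC.abs A).trace.re := by
  rw [CFC.abs, CFC.sqrt_eq_real_sqrt _ (star_mul_self_nonneg A), cfcₙ_eq_cfc,
    Matrix.star_eq_conjTranspose, trace_cfc (Matrix.posSemidef_conjTranspose_mul_self A).1]
  rfl

open scoped MatrixOrder in
lemma re_trace_mul_le_traceNorm {Z V : Matrix n n ℂ} {t : ℝ} (hZ : Z.IsHermitian)
    (hV : (t • (1 : Matrix n n ℂ) - V).PosSemidef) (hV' : (t • (1 : Matrix n n ℂ) + V).PosSemidef) :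
    (Z * V).trace.re ≤ t * traceNorm Z := by
  have hZ' : IsSelfAdjoint Z := hZ
  have h₁ := re_trace_mul_nonneg (Matrix.nonneg_iff_posSemidef.mp (CFC.posPart_nonneg Z)) hV
  have h₂ := re_trace_mul_nonneg (Matrix.nonneg_iff_posSemidef.mp (CFC.negPart_nonneg Z)) hV'
  rw [traceNorm_eq_trace_abs, ← CFC.posPart_add_negPart Z]
  conv_lhs => rw [← CFC.posPart_sub_negPart Z]
  simp only [sub_mul, mul_sub, mul_add, Matrix.trace_sub, Matrix.trace_add,
    Complex.sub_re, Complex.add_re, mul_smul_comm, mul_one, Matrix.trace_smul, Complex.smul_re,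
    smul_eq_mul] at h₁ h₂ ⊢
  linarith

open scoped MatrixOrder in
lemma traceNorm_sub_le {P N : Matrix n n ℂ} (hP : P.PosSemidef) (hN : N.PosSemidef) :
    traceNorm (P - N) ≤ (P + N).trace.re := by
  have hA : IsSelfAdjoint (P - N) := hP.1.sub hN.1
  set S : Matrix n n ℂ := cfc (fun x : ℝ => (SignType.sign x : ℝ)) (P - N) with hS
  have hc (f : ℝ → ℝ) : ContinuousOn f (spectrum ℝ (P - N)) :=
    (Matrix.finite_real_spectrum (A := P - N)).continuousOn f
  have habs : CFC.abs (P - N) = (P - N) * S := by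
    rw [CFC.abs_eq_cfc_norm (P - N)]
    have h := cfc_mul (fun x : ℝ => x) (fun x : ℝ => (SignType.sign x : ℝ)) (P - N) (hc _) (hc _)
    rw [cfc_id' ℝ (P - N) hA] at h
    rw [hS, ← h]
    exact cfc_congr fun x _ => by simp [mul_comm x, Real.norm_eq_abs]
  have h₁ : (1 - S).PosSemidef := by
    rw [← Matrix.nonneg_iff_posSemidef, hS, ← cfc_one ℝ (P - N) hA, ← cfc_sub _ _ _ (hc _) (hc _)]
    refine cfc_nonneg fun x _ => ?_
    rcases lt_trichotomy x 0 with h | h | h <;> simp [h]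
  have h₂ : (1 + S).PosSemidef := by
    rw [← Matrix.nonneg_iff_posSemidef, hS, ← cfc_one ℝ (P - N) hA, ← cfc_add _ _ _ (hc _) (hc _)]
    refine cfc_nonneg fun x _ => ?_
    rcases lt_trichotomy x 0 with h | h | h <;> simp [h]
  rw [traceNorm_eq_trace_abs, habs]
  have h₃ := re_trace_mul_nonneg hP h₁
  have h₄ := re_trace_mul_nonneg hN h₂
  simp only [sub_mul, mul_sub, mul_add, Matrix.trace_sub, Matrix.trace_add,
    Complex.sub_re, Complex.add_re, mul_one] at h₃ h₄ ⊢
  linarith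

end TraceInequalities

section ConicDuality

open scoped Matrix.Norms.L2Operator MatrixOrder

/-- On Hermitian matrices, a real linear functional is the trace pairing with a Hermitian matrix. -/
lemma exists_isHermitian_re_trace_mul_eq (g : Matrix n n ℂ →ₗ[ℝ] ℝ) :
    ∃ Y : Matrix n n ℂ, Y.IsHermitian ∧
      ∀ X : Matrix n n ℂ, X.IsHermitian → g X = (Y * X).trace.re := by
  set Z : Matrix n n ℂ := Matrix.of fun a b =>
    (⟨g (Matrix.single b a 1), -g (Matrix.single b a Complex.I)⟩ : ℂ) with hZ
  have hg (X : Matrix n n ℂ) : g X = (Z * X).trace.re := by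
    have hs (a b : n) (z : ℂ) : g (Matrix.single a b z) = (Z b a * z).re := by
      have : Matrix.single a b z
          = z.re • Matrix.single a b (1 : ℂ) + z.im • Matrix.single a b Complex.I := by
        rw [Matrix.smul_single, Matrix.smul_single, ← Matrix.single_add]
        congr 1
        simp [Complex.re_add_im]
      rw [this, map_add, map_smul, map_smul]
      simp [hZ, Complex.mul_re, mul_comm]
    conv_lhs => rw [Matrix.matrix_eq_sum_single X]
    simp only [map_sum, hs, Matrix.trace, Matrix.diag_apply, Matrix.mul_apply, Complex.re_sum]
    exact Finset.sum_comm
  refine ⟨(1 / 2 : ℝ) • (Z + Zᴴ), ?_, fun X hX => ?_⟩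
  · rw [Matrix.IsHermitian, Matrix.conjTranspose_smul, Matrix.conjTranspose_add,
      Matrix.conjTranspose_conjTranspose, add_comm, star_trivial]
  · have : (Zᴴ * X).trace.re = (Z * X).trace.re := by
      conv_lhs => rw [← hX.eq, ← Matrix.conjTranspose_mul, Matrix.trace_conjTranspose,
        Matrix.trace_mul_comm]
      simp
    rw [hg, smul_mul_assoc, add_mul, Matrix.trace_smul, Matrix.trace_add, Complex.smul_re,
      Complex.add_re, this, smul_eq_mul]
    ring

lemma posSemidef_of_re_trace_mul_nonneg {m : Type*} [Fintype m] {Y : Matrix m m ℂ}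
    (hY : Y.IsHermitian)
    (h : ∀ R : Matrix m m ℂ, R.PosSemidef → 0 ≤ (Y * R).trace.re) : Y.PosSemidef := by
  refine Matrix.PosSemidef.of_dotProduct_mulVec_nonneg hY fun x => ?_
  have hx := h _ (Matrix.posSemidef_vecMulVec_self_star x)
  rw [Matrix.mul_vecMulVec, Matrix.trace_vecMulVec, dotProduct_comm] at hx
  exact Complex.le_def.mpr ⟨hx, (hY.im_star_dotProduct_mulVec_self x).symm⟩

lemma eq_of_re_trace_mul_eq {m : Type*} [Fintype m] {A B : Matrix m m ℂ}
    (hA : A.IsHermitian) (hB : B.IsHermitian)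
    (h : ∀ X : Matrix m m ℂ, X.IsHermitian → (A * X).trace.re = (B * X).trace.re) : A = B := by
  have h₁ := h _ (hA.sub hB)
  have h₂ := Complex.le_def.mp (Matrix.posSemidef_conjTranspose_mul_self (A - B)).trace_nonneg
  rw [← sub_eq_zero, ← Complex.sub_re, ← Matrix.trace_sub, ← sub_mul] at h₁
  rw [← sub_eq_zero, ← Matrix.trace_conjTranspose_mul_self_eq_zero_iff]
  refine Complex.ext ?_ h₂.2.symm
  rw [(hA.sub hB).eq, h₁, Complex.zero_re]

/-- Approximate Farkas lemma for Hermitian matrices. -/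
lemma exists_mem_forall_posSemidef {ι : Type*} [Fintype ι] (S : Submodule ℝ (ι → Matrix n n ℂ))
    (hS : ∀ x ∈ S, ∀ i, (x i).IsHermitian) (b : ι → Matrix n n ℂ) (hb : ∀ i, (b i).IsHermitian)
    (hdual : ∀ Y : ι → Matrix n n ℂ, (∀ i, (Y i).PosSemidef) →
      (∀ x ∈ S, ∑ i, (Y i * x i).trace.re = 0) → ∑ i, (Y i * b i).trace.re ≤ 0)
    {ε : ℝ} (hε : 0 < ε) :
    ∃ x ∈ S, ∀ i, (x i + ε • (1 : Matrix n n ℂ) - b i).PosSemidef := by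
  set T : Set (ι → Matrix n n ℂ) := {y | ∃ x ∈ S, ∀ i, (x i - y i).PosSemidef} with hT
  by_cases hbT : b ∈ closure T
  · obtain ⟨y, ⟨x, hx, hxy⟩, hby⟩ := Metric.mem_closure_iff.mp hbT ε hε
    refine ⟨x, hx, fun i => ?_⟩
    have hy : (y i).IsHermitian := by simpa using (hS x hx i).sub (hxy i).1
    have h₁ : ‖b i - y i‖ ≤ ε :=
      (dist_eq_norm (b i) (y i)).symm.trans_le ((dist_le_pi_dist b y i).trans hby.le)
    have h₂ : IsSelfAdjoint (b i - y i) := (hb i).sub hy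
    have h₃ := h₂.le_algebraMap_norm_self
    rw [Algebra.algebraMap_eq_smul_one, Matrix.le_iff] at h₃
    convert ((hxy i).add h₃).add (posSemidef_real_smul Matrix.PosSemidef.one (sub_nonneg.mpr h₁))
      using 1
    rw [sub_smul]
    abel
  · have hconv : Convex ℝ T := by
      rintro y ⟨x, hx, hxy⟩ y' ⟨x', hx', hxy'⟩ p q hp hq -
      refine ⟨p • x + q • x', S.add_mem (S.smul_mem p hx) (S.smul_mem q hx'), fun i => ?_⟩
      convert (posSemidef_real_smul (hxy i) hp).add (posSemidef_real_smul (hxy' i) hq) using 1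
      simp only [Pi.add_apply, Pi.smul_apply, smul_sub]
      abel
    obtain ⟨f, u, hfu, hub⟩ :=
      geometric_hahn_banach_closed_point hconv.closure isClosed_closure hbT
    have hcone (y : ι → Matrix n n ℂ) (hy : y ∈ T) : f y ≤ 0 := by
      by_contra! hpos
      obtain ⟨x, hx, hxy⟩ := hy
      have hu : 0 < u := by
        have := hfu 0 (subset_closure ⟨0, S.zero_mem, fun i => by simpa using .zero⟩)
        simpa using this
      have := hfu ((u / f y) • y) (subset_closure ⟨(u / f y) • x, S.smul_mem _ hx, fun i => by
        simpa [smul_sub] using posSemidef_real_smul (hxy i) (div_pos hu hpos).le⟩)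
      rw [map_smul, smul_eq_mul, div_mul_cancel₀ _ hpos.ne'] at this
      exact this.false
    have hu : 0 < f b := by
      have := hfu 0 (subset_closure ⟨0, S.zero_mem, fun i => by simpa using .zero⟩)
      rw [map_zero] at this
      exact this.trans hub
    choose Y hYherm hY using fun i : ι =>
      exists_isHermitian_re_trace_mul_eq
        ((f : (ι → Matrix n n ℂ) →ₗ[ℝ] ℝ) ∘ₗ LinearMap.single ℝ (fun _ => Matrix n n ℂ) i)
    have hf (x : ι → Matrix n n ℂ) (hx : ∀ i, (x i).IsHermitian) :
        f x = ∑ i, (Y i * x i).trace.re := by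
      conv_lhs => rw [← Finset.univ_sum_single x, map_sum]
      exact Finset.sum_congr rfl fun i _ => hY i (x i) (hx i)
    refine absurd (hdual Y (fun i => ?_) fun x hx => ?_) (not_le.mpr (hf b hb ▸ hu))
    · refine posSemidef_of_re_trace_mul_nonneg (hYherm i) fun R hR => ?_
      have h₁ := hcone (Pi.single i (-R)) ⟨0, S.zero_mem, fun j => by
        rcases eq_or_ne j i with rfl | hj
        · simpa using hR
        · simpa [hj] using .zero⟩
      have h₂ := hY i (-R) hR.1.neg
      simp only [LinearMap.comp_apply, LinearMap.single_apply, ContinuousLinearMap.coe_coe] at h₂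
      rw [h₂] at h₁
      simpa using h₁
    · rw [← hf x (hS x hx)]
      refine le_antisymm (hcone x ⟨x, hx, fun i => by simpa using .zero⟩) ?_
      have := hcone (-x) ⟨-x, S.neg_mem hx, fun i => by simpa using .zero⟩
      simpa using this

end ConicDuality

section SupportFunction

variable {α β γ δ : Type*} [Fintype α] [DecidableEq α] [Fintype β] [DecidableEq β]
  [Fintype γ] [DecidableEq γ] [Fintype δ] [DecidableEq δ]

/-- Feasibility of `V` with value `t` for the semidefinite program dual to the support function of
`PPT_k` at `ω`. -/
def IsDualFeasible (k : ℕ) (ω : Matrix (α × β) (α × β) ℂ) (t : ℝ)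
    (V : ℕ → Matrix (α × β) (α × β) ℂ) : Prop :=
  (V 0 - ω).PosSemidef ∧
    (∀ i < k, (V (i + 1) - ptB (V i)).PosSemidef ∧ (V (i + 1) + ptB (V i)).PosSemidef) ∧
    V k = t • 1

lemma IsDualFeasible.kron2 {k : ℕ} {ω : Matrix (α × β) (α × β) ℂ} {ω' : Matrix (γ × δ) (γ × δ) ℂ}
    {t t' : ℝ} {V : ℕ → Matrix (α × β) (α × β) ℂ} {V' : ℕ → Matrix (γ × δ) (γ × δ) ℂ}
    (hω : ω.PosSemidef) (hω' : ω'.PosSemidef)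
    (hV : IsDualFeasible k ω t V) (hV' : IsDualFeasible k ω' t' V') :
    IsDualFeasible k (kron2 ω ω') (t * t') (fun i => kron2 (V i) (V' i)) := by
  refine ⟨?_, fun i hi => ?_, ?_⟩
  · refine (posSemidef_kron2_sub hV.1 ?_ hV'.1 ?_).1
    · convert hV.1.add (hω.add hω) using 1; abel
    · convert hV'.1.add (hω'.add hω') using 1; abel
  · rw [ptB_kron2]
    exact posSemidef_kron2_sub (hV.2.1 i hi).1 (hV.2.1 i hi).2 (hV'.2.1 i hi).1 (hV'.2.1 i hi).2
  · simp only [hV.2.2, hV'.2.2, kron2_smul_smul, kron2_one_one]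

/-- Weak duality for the support function of `PPT_k`. -/
lemma IsDualFeasible.re_trace_mul_le {k : ℕ} (hk : 1 ≤ k) {ω σ : Matrix (α × β) (α × β) ℂ} {t : ℝ}
    (ht : 0 ≤ t) {V : ℕ → Matrix (α × β) (α × β) ℂ} (hV : IsDualFeasible k ω t V)
    (hσ : memPPTk k σ) : (σ * ω).trace.re ≤ t := by
  obtain ⟨hσ, W, rfl, hherm, hW, hnorm⟩ := hσ
  obtain ⟨m, rfl⟩ := Nat.exists_eq_add_of_le' hk
  have hchain : ∀ i ≤ m, (W 1 * ω).trace.re ≤ (W (i + 1) * V i).trace.re := by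
    intro i
    induction i with
    | zero =>
      intro _
      have := re_trace_mul_nonneg hσ hV.1
      rw [mul_sub, Matrix.trace_sub, Complex.sub_re] at this
      simpa using this
    | succ i ih =>
      intro hi
      refine (ih (by lia)).trans ?_
      rw [← trace_ptB_mul_ptB]
      have hWi := hW (i + 1) (by simp; lia)
      exact QIT.re_trace_mul_le hWi.1 hWi.2 (hV.2.1 i (by lia)).1 (hV.2.1 i (by lia)).2
  have hlast := hV.2.1 m (by lia)
  rw [hV.2.2] at hlast
  calc (W 1 * ω).trace.re ≤ (W (m + 1) * V m).trace.re := hchain m le_rfl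
    _ = (ptB (W (m + 1)) * ptB (V m)).trace.re := by rw [trace_ptB_mul_ptB]
    _ ≤ t * traceNorm (ptB (W (m + 1))) :=
      re_trace_mul_le_traceNorm (isHermitian_ptB (hherm _ (by simp))) hlast.1 hlast.2
    _ ≤ t * 1 := mul_le_mul_of_nonneg_left hnorm ht
    _ = t := mul_one t

lemma memPPTk_of_chain {k : ℕ} (hk : 1 ≤ k) {σ : Matrix (α × β) (α × β) ℂ}
    {P N : ℕ → Matrix (α × β) (α × β) ℂ} (hσ : σ.PosSemidef)
    (hP : ∀ i, (P i).PosSemidef) (hN : ∀ i, (N i).PosSemidef) (h₀ : ptB σ = P 0 - N 0)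
    (hstep : ∀ i, i + 1 < k → ptB (P i + N i) = P (i + 1) - N (i + 1))
    (htr : (P (k - 1) + N (k - 1)).trace.re ≤ 1) : memPPTk k σ := by
  obtain ⟨m, rfl⟩ := Nat.exists_eq_add_of_le' hk
  set W : ℕ → Matrix (α × β) (α × β) ℂ := fun i => if i ≤ 1 then σ else P (i - 2) + N (i - 2)
  have hW : ∀ i ≤ m, ptB (W (i + 1)) = P i - N i := by
    rintro (_ | i) hi
    · exact h₀
    · exact hstep i (by lia)
  refine ⟨hσ, W, rfl, fun i _ => ?_, fun i hi => ?_, ?_⟩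
  · by_cases h : i ≤ 1
    · simpa [W, h] using hσ.1
    · simpa [W, h] using (hP (i - 2)).1.add (hN (i - 2)).1
  · rw [Finset.mem_Icc] at hi
    obtain ⟨j, rfl⟩ := Nat.exists_eq_add_of_le' hi.1
    have hWj : W (j + 1 + 1) = P j + N j := rfl
    rw [hW j (by lia), hWj]
    constructor
    · convert (hN j).add (hN j) using 1; abel
    · convert (hP j).add (hP j) using 1; abel
  · rw [hW m le_rfl]
    exact (traceNorm_sub_le (hP m) (hN m)).trans htr

lemma memPPTk_zero {k : ℕ} (hk : 1 ≤ k) : memPPTk k (0 : Matrix (α × β) (α × β) ℂ) :=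
  memPPTk_of_chain (P := 0) (N := 0) hk .zero (fun _ => .zero) (fun _ => .zero)
    (by simp [ptB_zero]) (fun i _ => by simp [ptB_zero]) (by simp)

/-- The left-hand sides of the constraints of the dual program. -/
def dualConstraint (k : ℕ) (V : ℕ → Matrix (α × β) (α × β) ℂ) :
    Option (Fin k × Bool) → Matrix (α × β) (α × β) ℂ
  | none => V 0
  | some (i, true) => V (i + 1) - ptB (V i)
  | some (i, false) => V (i + 1) + ptB (V i)

/-- The space of values of `dualConstraint` on Hermitian sequences vanishing from `k` on. -/
def dualConstraintSubmodule (α β : Type*) (k : ℕ) :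
    Submodule ℝ (Option (Fin k × Bool) → Matrix (α × β) (α × β) ℂ) where
  carrier := {x | ∃ V : ℕ → Matrix (α × β) (α × β) ℂ, (∀ i, (V i).IsHermitian) ∧
    (∀ i ≥ k, V i = 0) ∧ dualConstraint k V = x}
  zero_mem' := ⟨0, fun _ => Matrix.isHermitian_zero, fun _ _ => rfl, by
    funext o
    rcases o with _ | ⟨i, _ | _⟩ <;> simp [dualConstraint, ptB_zero]⟩
  add_mem' := by
    rintro _ _ ⟨V, hV, hVk, rfl⟩ ⟨V', hV', hVk', rfl⟩
    refine ⟨V + V', fun i => (hV i).add (hV' i), fun i hi => by simp [hVk i hi, hVk' i hi], ?_⟩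
    funext o
    rcases o with _ | ⟨i, _ | _⟩ <;> simp only [dualConstraint, ptB_add, Pi.add_apply] <;> abel
  smul_mem' := by
    rintro r _ ⟨V, hV, hVk, rfl⟩
    refine ⟨r • V, fun i => (hV i).smul (IsSelfAdjoint.all r), fun i hi => by simp [hVk i hi], ?_⟩
    funext o
    rcases o with _ | ⟨i, _ | _⟩ <;>
      simp [dualConstraint, ptB_smul, smul_sub, smul_add]

lemma sum_re_trace_mul_dualConstraint {k : ℕ}
    (Y : Option (Fin k × Bool) → Matrix (α × β) (α × β) ℂ) {P N : ℕ → Matrix (α × β) (α × β) ℂ}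
    (hP : ∀ i : Fin k, Y (some (i, true)) = P i) (hN : ∀ i : Fin k, Y (some (i, false)) = N i)
    (V : ℕ → Matrix (α × β) (α × β) ℂ) :
    ∑ o, (Y o * dualConstraint k V o).trace.re
      = (Y none * V 0).trace.re + ∑ i ∈ Finset.range k, ((P i + N i) * V (i + 1)).trace.re
        - ∑ i ∈ Finset.range k, ((P i - N i) * ptB (V i)).trace.re := by
  rw [Fintype.sum_option, Fintype.sum_prod_type, Finset.sum_range, Finset.sum_range, add_sub_assoc,
    ← Finset.sum_sub_distrib]
  congr 1
  refine Finset.sum_congr rfl fun i _ => ?_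
  rw [Fintype.sum_bool, hP, hN]
  simp only [dualConstraint, mul_add, mul_sub, add_mul, sub_mul, Matrix.trace_add,
    Matrix.trace_sub, Complex.add_re, Complex.sub_re]
  ring

/-- Multipliers that annihilate the dual constraints form a chain as in `PPT_k`. -/
lemma chain_of_annihilates {k : ℕ} (hk : 1 ≤ k)
    {σ : Matrix (α × β) (α × β) ℂ} {P N : ℕ → Matrix (α × β) (α × β) ℂ} (hσ : σ.PosSemidef)
    (hP : ∀ i, (P i).PosSemidef) (hN : ∀ i, (N i).PosSemidef)
    (h : ∀ V : ℕ → Matrix (α × β) (α × β) ℂ, (∀ i, (V i).IsHermitian) → (∀ i ≥ k, V i = 0) →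
      (σ * V 0).trace.re + ∑ i ∈ Finset.range k, ((P i + N i) * V (i + 1)).trace.re
        - ∑ i ∈ Finset.range k, ((P i - N i) * ptB (V i)).trace.re = 0) :
    ptB σ = P 0 - N 0 ∧ ∀ i, i + 1 < k → ptB (P i + N i) = P (i + 1) - N (i + 1) := by
  have hsingle (j : ℕ) (hj : j < k) (X : Matrix (α × β) (α × β) ℂ) (hX : X.IsHermitian) :=
    h (Pi.single j X) (fun i => by
      rcases eq_or_ne i j with rfl | hij
      · simpa using hX
      · simp [hij]) (fun i hi => by simp [show i ≠ j by lia])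
  have hpt (j : ℕ) (hj : j < k) (X : Matrix (α × β) (α × β) ℂ) :
      ∑ i ∈ Finset.range k, ((P i - N i) * ptB ((Pi.single j X : ℕ → _) i)).trace.re
        = (ptB (P j - N j) * X).trace.re := by
    rw [Finset.sum_eq_single_of_mem j (by simpa using hj)
      (fun i _ hij => by simp [hij, ptB_zero]), trace_ptB_mul, Pi.single_eq_same]
  constructor
  · rw [← ptB_ptB (P 0 - N 0)]
    congr 1
    refine eq_of_re_trace_mul_eq hσ.1 (isHermitian_ptB ((hP 0).1.sub (hN 0).1)) fun X hX => ?_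
    have := hsingle 0 (by lia) X hX
    rw [hpt 0 (by lia)] at this
    simpa [sub_eq_zero] using this
  · intro j hj
    rw [← ptB_ptB (P (j + 1) - N (j + 1))]
    congr 1
    refine eq_of_re_trace_mul_eq ((hP j).1.add (hN j).1)
      (isHermitian_ptB ((hP (j + 1)).1.sub (hN (j + 1)).1)) fun X hX => ?_
    have := hsingle (j + 1) hj X hX
    rw [hpt (j + 1) hj, Finset.sum_eq_single_of_mem j (by simp; lia)
      (fun i _ hij => by simp [hij])] at this
    simpa [sub_eq_zero] using this

/-- Strong duality for the support function of `PPT_k`. -/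
lemma exists_isDualFeasible {k : ℕ} (hk : 1 ≤ k) {ω : Matrix (α × β) (α × β) ℂ}
    (hω : ω.IsHermitian) {t : ℝ}
    (ht : ∀ σ : Matrix (α × β) (α × β) ℂ, memPPTk k σ → (σ * ω).trace.re ≤ t)
    {ε : ℝ} (hε : 0 < ε) : ∃ V, IsDualFeasible k ω (t + ε) V := by
  have ht₀ : 0 ≤ t := by simpa using ht 0 (memPPTk_zero hk)
  have hk₀ : (0 : ℝ) < k + 1 := by positivity
  set η : ℝ := ε / (k + 1) with hη
  have hη₀ : 0 < η := div_pos hε hk₀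
  set T : ℕ → Matrix (α × β) (α × β) ℂ := fun i => if i = k then t • 1 else 0 with hT
  have hT₁ : ∀ i ≠ k, T i = 0 := fun i hi => if_neg hi
  have hTk : T k = t • 1 := if_pos rfl
  have hTherm (i : ℕ) : (T i).IsHermitian := by
    by_cases hi : i = k
    · rw [hi, hTk]; exact Matrix.isHermitian_one.smul (IsSelfAdjoint.all t)
    · rw [hT₁ i hi]; exact Matrix.isHermitian_zero
  obtain ⟨_, ⟨V, hV, hVk, rfl⟩, hx⟩ := exists_mem_forall_posSemidef
    (dualConstraintSubmodule α β k)
    (by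
      rintro _ ⟨V, hV, -, rfl⟩ (_ | ⟨i, _ | _⟩)
      · exact hV 0
      · exact (hV _).add (isHermitian_ptB (hV _))
      · exact (hV _).sub (isHermitian_ptB (hV _)))
    (fun o => o.elim ω fun p => -T (p.1 + 1))
    (by
      rintro (_ | ⟨i, _⟩)
      · exact hω
      · exact (hTherm _).neg)
    (by
      intro Y hY hYS
      set P : ℕ → Matrix (α × β) (α × β) ℂ :=
        fun i => if h : i < k then Y (some (⟨i, h⟩, true)) else 0 with hP
      set N : ℕ → Matrix (α × β) (α × β) ℂ :=
        fun i => if h : i < k then Y (some (⟨i, h⟩, false)) else 0 with hN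
      have hYP (i : Fin k) : Y (some (i, true)) = P i := by simp [hP]
      have hYN (i : Fin k) : Y (some (i, false)) = N i := by simp [hN]
      have hP₀ (i : ℕ) : (P i).PosSemidef := by
        by_cases h : i < k
        · simpa [hP, h] using hY _
        · simpa [hP, h] using .zero
      have hN₀ (i : ℕ) : (N i).PosSemidef := by
        by_cases h : i < k
        · simpa [hN, h] using hY _
        · simpa [hN, h] using .zero
      obtain ⟨hchain₀, hchain⟩ := chain_of_annihilates hk (hY none) hP₀ hN₀ fun V hV hVk => by
        rw [← sum_re_trace_mul_dualConstraint Y hYP hYN]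
        exact hYS _ ⟨V, hV, hVk, rfl⟩
      set s : ℝ := (P (k - 1) + N (k - 1)).trace.re with hs
      have hs₀ : 0 ≤ s := (Complex.le_def.mp ((hP₀ _).add (hN₀ _)).trace_nonneg).1
      have hsum : ∑ o : Option (Fin k × Bool),
          (Y o * o.elim ω fun p => -T (p.1 + 1)).trace.re = (Y none * ω).trace.re - t * s := by
        rw [Fintype.sum_option, Fintype.sum_prod_type, sub_eq_add_neg]
        congr 1
        have : ∀ i : Fin k, ∑ c : Bool,
            (Y (some (i, c)) * (some (i, c)).elim ω fun p => -T (p.1 + 1)).trace.re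
              = -((P i + N i) * T (i + 1)).trace.re := by
          intro i
          rw [Fintype.sum_bool, hYP, hYN]
          simp only [Option.elim_some, add_mul, mul_neg, Matrix.trace_neg, Matrix.trace_add,
            Complex.neg_re, Complex.add_re]
          ring
        rw [Fintype.sum_congr _ _ this,
          ← Finset.sum_range (fun i => -((P i + N i) * T (i + 1)).trace.re),
          Finset.sum_eq_single_of_mem (k - 1) (by simp; lia)
            (fun i hi hik => by rw [hT₁ (i + 1) (by lia)]; simp),
          Nat.sub_add_cancel hk, hTk, mul_smul_comm, mul_one, Matrix.trace_smul, Complex.smul_re,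
          smul_eq_mul]
      rw [hsum, sub_nonpos]
      have hscale (r : ℝ) (hr : s < r) : (Y none * ω).trace.re ≤ t * r := by
        have hr₀ : 0 < r := hs₀.trans_lt hr
        have hmem : memPPTk k (r⁻¹ • Y none) := by
          refine memPPTk_of_chain (P := fun i => r⁻¹ • P i) (N := fun i => r⁻¹ • N i) hk
            (posSemidef_real_smul (hY none) (by positivity))
            (fun i => posSemidef_real_smul (hP₀ i) (by positivity))
            (fun i => posSemidef_real_smul (hN₀ i) (by positivity)) ?_ (fun i hi => ?_) ?_
          · rw [ptB_smul, hchain₀, smul_sub]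
          · rw [← smul_add, ptB_smul, hchain i hi, smul_sub]
          · rw [← smul_add, Matrix.trace_smul, Complex.smul_re, smul_eq_mul, inv_mul_le_one₀ hr₀]
            exact hr.le
        have := ht _ hmem
        rwa [smul_mul_assoc, Matrix.trace_smul, Complex.smul_re, smul_eq_mul,
          inv_mul_le_iff₀ hr₀, mul_comm r] at this
      exact ge_of_tendsto ((continuous_const_mul t).continuousWithinAt (s := Set.Ioi s))
        (Filter.eventually_of_mem self_mem_nhdsWithin hscale))
    hη₀
  have hbound (i : ℕ) (hi : i < k) :
      (V (i + 1) + T (i + 1) - ptB (V i) + η • 1).PosSemidef ∧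
        (V (i + 1) + T (i + 1) + ptB (V i) + η • 1).PosSemidef := by
    constructor
    · convert hx (some (⟨i, hi⟩, true)) using 1
      simp only [dualConstraint, Option.elim_some]
      abel
    · convert hx (some (⟨i, hi⟩, false)) using 1
      simp only [dualConstraint, Option.elim_some]
      abel
  refine ⟨fun i => V i + T i + ((i + 1) * η) • 1, ?_, fun i hi => ?_, ?_⟩
  · convert hx none using 1
    simp [dualConstraint, hT₁ 0 (by lia)]
  · simp only [ptB_add, ptB_smul, ptB_one, hT₁ i hi.ne, add_zero]
    obtain ⟨h₁, h₂⟩ := hbound i hi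
    constructor
    · convert h₁ using 1
      push_cast
      module
    · convert h₂.add (posSemidef_real_smul Matrix.PosSemidef.one
        (show 0 ≤ 2 * (i + 1) * η by positivity)) using 1
      push_cast
      module
  · simp only [hVk k le_rfl, hTk, zero_add, ← add_smul]
    rw [hη, mul_div_cancel₀ _ hk₀.ne']

lemma pptkSuppFn_le_of_isDualFeasible {k : ℕ} (hk : 1 ≤ k) {ω : Matrix (α × β) (α × β) ℂ} {t : ℝ}
    (ht : 0 ≤ t) {V : ℕ → Matrix (α × β) (α × β) ℂ} (hV : IsDualFeasible k ω t V) :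
    pptkSuppFn k ω ≤ t :=
  csSup_le ⟨_, 0, memPPTk_zero hk, rfl⟩ fun _ ⟨_, hσ, hr⟩ => hr ▸ hV.re_trace_mul_le hk ht hσ

open scoped Matrix.Norms.L2Operator MatrixOrder in
lemma bddAbove_re_trace_memPPTk {k : ℕ} (hk : 1 ≤ k) {ω : Matrix (α × β) (α × β) ℂ}
    (hω : ω.IsHermitian) :
    BddAbove {r : ℝ | ∃ σ : Matrix (α × β) (α × β) ℂ, memPPTk k σ ∧ r = (σ * ω).trace.re} := by
  have hone : (‖ω‖ • (1 : Matrix (α × β) (α × β) ℂ)).PosSemidef :=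
    posSemidef_real_smul .one (norm_nonneg ω)
  have hV : IsDualFeasible k ω ‖ω‖ fun _ => ‖ω‖ • 1 := by
    refine ⟨?_, fun i _ => ?_, rfl⟩
    · have hω' : IsSelfAdjoint ω := hω
      have := hω'.le_algebraMap_norm_self
      rwa [Algebra.algebraMap_eq_smul_one, Matrix.le_iff] at this
    · rw [ptB_smul, ptB_one]
      exact ⟨by simpa using .zero, hone.add hone⟩
  exact ⟨‖ω‖, fun _ ⟨_, hσ, hr⟩ => hr ▸ hV.re_trace_mul_le hk (norm_nonneg ω) hσ⟩

lemma re_trace_mul_le_pptkSuppFn {k : ℕ} (hk : 1 ≤ k) {ω σ : Matrix (α × β) (α × β) ℂ}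
    (hω : ω.IsHermitian) (hσ : memPPTk k σ) : (σ * ω).trace.re ≤ pptkSuppFn k ω :=
  le_csSup (bddAbove_re_trace_memPPTk hk hω) ⟨σ, hσ, rfl⟩

lemma pptkSuppFn_nonneg {k : ℕ} (hk : 1 ≤ k) {ω : Matrix (α × β) (α × β) ℂ}
    (hω : ω.IsHermitian) : 0 ≤ pptkSuppFn k ω := by
  simpa using re_trace_mul_le_pptkSuppFn hk hω (memPPTk_zero hk)

end SupportFunction

/-- sub-multiplicativity of the support function of the `PPT_k` set. -/
theorem pptk_suppFn_submultiplicative {dA dB dA' dB' : ℕ} (k : ℕ) (hk : 2 ≤ k)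
    (ω : Matrix (Fin dA × Fin dB) (Fin dA × Fin dB) ℂ)
    (ω' : Matrix (Fin dA' × Fin dB') (Fin dA' × Fin dB') ℂ)
    (hω : ω.PosSemidef) (hω' : ω'.PosSemidef) :
    pptkSuppFn k (kron2 ω ω') ≤ pptkSuppFn k ω * pptkSuppFn k ω' := by
  have hk₁ : 1 ≤ k := one_le_two.trans hk
  have h₀ := pptkSuppFn_nonneg hk₁ hω.1
  have h₀' := pptkSuppFn_nonneg hk₁ hω'.1
  have hle (ε : ℝ) (hε : 0 < ε) :
      pptkSuppFn k (kron2 ω ω') ≤ (pptkSuppFn k ω + ε) * (pptkSuppFn k ω' + ε) := by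
    obtain ⟨V, hV⟩ := exists_isDualFeasible hk₁ hω.1
      (fun σ hσ => re_trace_mul_le_pptkSuppFn hk₁ hω.1 hσ) hε
    obtain ⟨V', hV'⟩ := exists_isDualFeasible hk₁ hω'.1
      (fun σ hσ => re_trace_mul_le_pptkSuppFn hk₁ hω'.1 hσ) hε
    exact pptkSuppFn_le_of_isDualFeasible hk₁ (by positivity) (hV.kron2 hω hω' hV')
  have hcont : Continuous fun ε : ℝ => (pptkSuppFn k ω + ε) * (pptkSuppFn k ω' + ε) := by
    fun_prop
  have hlim := hcont.continuousWithinAt (s := Set.Ioi 0) (x := 0)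
  simp only [ContinuousWithinAt, add_zero] at hlim
  exact ge_of_tendsto hlim (Filter.eventually_of_mem self_mem_nhdsWithin hle)

end QIT
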